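/- Let R be a valuation ring whose fraction field K is the fraction field of a Noetherian local domain (O, m) with R dominating O (i.e., O ⊆ R and m = m_R ∩ O). Then the height (Krull dimension) of R is at most the Krull dimension of O; in particular R has finite height. -/

import Mathlib

open Polynomial in
attribute [local instance] Polynomial.algebra Polynomial.isLocalization in
/-- A prime of `A[X]` has height at most one more than its contraction to `A`. -/
theorem Polynomial.height_le_height_comap_C_add_one {A : Type*} [CommRing A] [IsNoetherianRing A]
    (P : Ideal A[X]) [P.IsPrime] : P.height ≤ (P.comap C).height + 1 := by
  set p : Ideal A := P.comap C
  have : P.LiesOver p := ⟨rfl⟩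
  let Aₚ := Localization.AtPrime p
  have disj : Disjoint (p.primeCompl.map C : Set A[X]) P := by
    refine Set.disjoint_left.mpr fun a ⟨b, hb⟩ ha ↦ hb.1 ?_
    change C b ∈ P
    rwa [hb.2]
  let P' : Ideal Aₚ[X] := P.map (algebraMap A[X] Aₚ[X])
  have hP' : P'.IsPrime :=
    IsLocalization.isPrime_of_isPrime_disjoint (p.primeCompl.map C) _ _ ‹_› disj
  have hlies : P'.LiesOver (p.map (algebraMap A Aₚ)) :=
    IsLocalization.liesOver_of_isPrime_of_disjoint p.primeCompl _ _ disj
  have hmax : p.map (algebraMap A Aₚ) = IsLocalRing.maximalIdeal Aₚ :=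
    Localization.AtPrime.map_eq_maximalIdeal
  obtain ⟨M, hM, hPM⟩ := P'.exists_le_maximal hP'.ne_top
  have : M.LiesOver (IsLocalRing.maximalIdeal Aₚ) := by
    refine ⟨(IsLocalRing.maximalIdeal.isMaximal Aₚ).eq_of_le (Ideal.IsPrime.under _ M).ne_top ?_⟩
    rw [← hmax, hlies.over]
    exact Ideal.comap_mono hPM
  rw [← IsLocalization.height_map_of_disjoint (S := Aₚ[X]) (p.primeCompl.map C) P disj,
    ← IsLocalization.height_map_of_disjoint (S := Aₚ) p.primeCompl p
      (Set.disjoint_left.mpr fun _ a b ↦ a b), hmax,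
    ← Polynomial.height_eq_height_add_one (IsLocalRing.maximalIdeal Aₚ) M]
  exact Ideal.height_mono hPM

/-- Contraction along a surjection from a domain with nonzero kernel strictly increases the heights
of primes. -/
theorem Ideal.height_add_one_le_height_comap_of_surjective {A B : Type*} [CommRing A] [IsDomain A]
    [CommRing B] [IsNoetherianRing B] {f : A →+* B} (hf : Function.Surjective f)
    (hker : RingHom.ker f ≠ ⊥) (P : Ideal B) [P.IsPrime] :
    P.height + 1 ≤ (P.comap f).height := by
  obtain ⟨l, hl, hlen⟩ := P.exists_ltSeries_length_eq_height
  have hmono : StrictMono (PrimeSpectrum.comap f) := fun a b h ↦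
    (Ideal.comap_mono h.le).lt_of_ne fun hab ↦
      h.ne (PrimeSpectrum.ext (Ideal.comap_injective_of_surjective f hf hab))
  have hbot : ⊥ < (l.map _ hmono).head := bot_lt_iff_ne_bot.mpr fun h ↦ hker <| le_bot_iff.mp <|
    (Ideal.comap_mono bot_le).trans (congrArg PrimeSpectrum.asIdeal h).le
  let l' := (l.map _ hmono).cons ⊥ hbot
  rw [← hlen]
  refine le_trans ?_ ((Order.length_le_height (p := l') ?_).trans_eq
    (PrimeSpectrum.height_eq_orderHeight ⟨P.comap f, inferInstance⟩).symm)
  · simp [l']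
  · simp [l', hl]
    rfl

/-- If `B = A[x]` with `x` algebraic over the Noetherian domain `A`, then contraction to `A` does
not decrease heights of primes. -/
theorem Ideal.height_le_height_comap_comp_C {A B : Type*} [CommRing A] [IsDomain A]
    [IsNoetherianRing A] [CommRing B] {f : Polynomial A →+* B} (hf : Function.Surjective f)
    (hker : RingHom.ker f ≠ ⊥) (P : Ideal B) [P.IsPrime] :
    P.height ≤ (P.comap (f.comp Polynomial.C)).height := by
  have : IsNoetherianRing B := isNoetherianRing_of_surjective _ _ f hf
  have h := (Ideal.height_add_one_le_height_comap_of_surjective hf hker P).trans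
    (Polynomial.height_le_height_comap_C_add_one (P.comap f))
  exact (ENat.add_le_add_iff_right ENat.one_ne_top).mp h

/-- Contraction from a finitely generated subalgebra of an algebraic extension domain to the
Noetherian base does not decrease heights of primes. -/
theorem Ideal.height_comap_adjoin_le {A B : Type*} [CommRing A] [IsDomain A]
    [IsNoetherianRing A] [CommRing B] [IsDomain B] [Algebra A B] [FaithfulSMul A B]
    [Algebra.IsAlgebraic A B] (s : Finset B) (P : Ideal B) [P.IsPrime] :
    (P.comap (algebraMap (Algebra.adjoin A (s : Set B)) B)).height ≤
      (P.comap (algebraMap A B)).height := by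
  classical
  induction s using Finset.induction_on with
  | empty =>
    let e : A ≃+* Algebra.adjoin A ((∅ : Finset B) : Set B) :=
      RingEquiv.ofBijective (algebraMap A _) ⟨FaithfulSMul.algebraMap_injective _ _, fun y ↦ by
        have := y.2
        simp only [Finset.coe_empty, Algebra.adjoin_empty, Algebra.mem_bot] at this
        obtain ⟨a, ha⟩ := this
        exact ⟨a, Subtype.ext ha⟩⟩
    rw [← e.height_comap]
    exact le_rfl
  | insert x s _ ih =>
    set S := Algebra.adjoin A (s : Set B)
    set T := Algebra.adjoin A ((insert x s : Finset B) : Set B) with hT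
    have hTr : T = (Algebra.adjoin S {x}).restrictScalars A := by
      rw [hT, Finset.coe_insert, Set.insert_eq, Set.union_comm,
        Algebra.adjoin_union_eq_adjoin_adjoin]
    have hmem (p : Polynomial S) : Polynomial.aeval x p ∈ T := by
      rw [hTr, Subalgebra.mem_restrictScalars]
      exact Polynomial.aeval_mem_adjoin_singleton _ _
    let f : Polynomial S →+* T := (Polynomial.aeval (R := S) x).toRingHom.codRestrict T hmem
    have hf : Function.Surjective f := by
      rintro ⟨y, hy⟩
      rw [hTr, Subalgebra.mem_restrictScalars, Algebra.adjoin_singleton_eq_range_aeval] at hy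
      obtain ⟨p, hp⟩ := hy
      exact ⟨p, Subtype.ext hp⟩
    have hker : RingHom.ker f ≠ ⊥ := by
      obtain ⟨p, hp, hpx⟩ : IsAlgebraic S x :=
        (Algebra.IsAlgebraic.isAlgebraic (R := A) x).extendScalars
          (FaithfulSMul.algebraMap_injective A S)
      exact fun h ↦ hp <| (Submodule.eq_bot_iff _).mp h p (Subtype.ext hpx)
    have : IsNoetherianRing S := isNoetherianRing_of_fg ⟨s, rfl⟩
    refine le_trans ?_ ih
    refine (Ideal.height_le_height_comap_comp_C hf hker _).trans (le_of_eq ?_)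
    rw [Ideal.comap_comap]
    congr 2
    ext a
    exact Polynomial.aeval_C (A := B) x a

/-- An algebraic extension domain of a Noetherian domain `A` has Krull dimension at most that
of `A`. -/
theorem ringKrullDim_le_of_isAlgebraic_of_isNoetherianRing {A B : Type*} [CommRing A] [IsDomain A]
    [IsNoetherianRing A] [CommRing B] [IsDomain B] [Algebra A B] [FaithfulSMul A B]
    [Algebra.IsAlgebraic A B] : ringKrullDim B ≤ ringKrullDim A := by
  classical
  refine iSup_le fun l ↦ ?_
  choose x hx hx' using fun i : Fin l.length ↦
    SetLike.exists_of_lt (show (l i.castSucc).asIdeal < (l i.succ).asIdeal from l.step i)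
  let s := Finset.univ.image x
  let T := Algebra.adjoin A (s : Set B)
  let l' : LTSeries (PrimeSpectrum T) :=
    { length := l.length
      toFun := fun i ↦ (l i).comap (algebraMap T B)
      step := fun i ↦ by
        refine lt_of_le_of_ne (Ideal.comap_mono (l.step i).le) fun h ↦ hx' i ?_
        have hxT : x i ∈ T := Algebra.subset_adjoin (by simp [s])
        exact h.ge (show (⟨x i, hxT⟩ : T) ∈ (l i.succ).asIdeal.comap (algebraMap T B) from hx i) }
  have h1 : (l.length : ℕ∞) ≤ (l.last.asIdeal.comap (algebraMap T B)).height := by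
    refine le_of_le_of_eq ?_ (PrimeSpectrum.height_eq_orderHeight l'.last).symm
    exact Order.length_le_height (p := l') le_rfl
  have h2 := h1.trans (Ideal.height_comap_adjoin_le s l.last.asIdeal)
  exact (WithBot.coe_le_coe.mpr h2).trans
    (Ideal.height_le_ringKrullDim_of_ne_top Ideal.IsPrime.ne_top')

/-- if a valuation ring `R` dominates a Noetherian local domain `O` with the
same fraction field `K`, then the height (Krull dimension) of `R` is at most the Krull
dimension of `O`; in particular it is finite. -/
theorem stmt5 (O R K : Type) [CommRing O] [IsDomain O] [IsNoetherianRing O] [IsLocalRing O]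
    [CommRing R] [IsDomain R] [ValuationRing R]
    [Field K] [Algebra O K] [IsFractionRing O K] [Algebra R K] [IsFractionRing R K]
    [Algebra O R] [IsScalarTower O R K]
    (hdom : IsLocalHom (algebraMap O R)) :
    ringKrullDim R ≤ ringKrullDim O ∧ ringKrullDim R < ⊤ := by
  have hinj : Function.Injective (algebraMap O R) := by
    refine .of_comp (f := algebraMap R K) ?_
    rw [← RingHom.coe_comp, ← IsScalarTower.algebraMap_eq]
    exact IsFractionRing.injective O K
  have : FaithfulSMul O R := (faithfulSMul_iff_algebraMap_injective O R).mpr hinj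
  have : Algebra.IsAlgebraic O K := IsLocalization.isAlgebraic K (nonZeroDivisors O)
  have : Algebra.IsAlgebraic O R :=
    ⟨fun x ↦ (isAlgebraic_algebraMap_iff (IsFractionRing.injective R K)).mp
      (Algebra.IsAlgebraic.isAlgebraic _)⟩
  have h := ringKrullDim_le_of_isAlgebraic_of_isNoetherianRing (A := O) (B := R)
  exact ⟨h, h.trans_lt ringKrullDim_lt_top⟩
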